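/- Let G be a group, σ : G → G an involutive group automorphism (σ ∘ σ = id), and H a self-normalizing subgroup of G (N_G(H) = H). Suppose σ(H) = aHa⁻¹ for some a ∈ G. Then the map μ : G/H → G/H, gH ↦ (σ(g)·a)H is a well-defined σ-equivariant involution of the coset space G/H, and it is the unique σ-equivariant involution of G/H. -/

import Mathlib

/-- If `σ(H) = aHa⁻¹`, then `h ∈ H` if and only if `a⁻¹σ(h)a ∈ H`. -/
theorem mem_iff_inv_mul_map_mul_mem {G : Type*} [Group G] {σ : G ≃* G} {H : Subgroup G} {a : G}
    (ha : H.map σ.toMonoidHom = H.map (MulAut.conj a).toMonoidHom) (h : G) :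
    h ∈ H ↔ a⁻¹ * σ h * a ∈ H := by
  have h₁ : σ h ∈ H.map σ.toMonoidHom ↔ h ∈ H :=
    Subgroup.mem_map_iff_mem (f := σ.toMonoidHom) σ.injective
  have h₂ : MulAut.conj a (a⁻¹ * σ h * a) ∈ H.map (MulAut.conj a).toMonoidHom ↔
      a⁻¹ * σ h * a ∈ H :=
    Subgroup.mem_map_iff_mem (f := (MulAut.conj a).toMonoidHom) (MulAut.conj a).injective
  have h₃ : MulAut.conj a (a⁻¹ * σ h * a) = σ h := by
    rw [MulAut.conj_apply]; group
  rw [← h₁, ha, ← h₂, h₃]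

/-- An injective `σ`-equivariant self-map of `G ⧸ H` sending `H` to `bH` satisfies
`h ∈ H` if and only if `b⁻¹σ(h)b ∈ H`. -/
theorem mem_iff_of_equivariant_injective {G : Type*} [Group G] {σ : G ≃* G} {H : Subgroup G}
    {μ : G ⧸ H → G ⧸ H} (hμ : ∀ (g : G) (x : G ⧸ H), μ (g • x) = σ g • μ x)
    (hinj : Function.Injective μ) {b : G} (hb : μ ((1 : G) : G ⧸ H) = (b : G ⧸ H)) (h : G) :
    h ∈ H ↔ b⁻¹ * σ h * b ∈ H := by
  have h₁ : μ (h : G ⧸ H) = ((σ h * b : G) : G ⧸ H) := by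
    simpa [hb] using hμ h ((1 : G) : G ⧸ H)
  rw [mul_assoc, ← QuotientGroup.eq, ← h₁, ← hb, hinj.eq_iff, QuotientGroup.eq, inv_one, one_mul]

/-- Let `σ` be an involutive group automorphism of `G` and `H` a
self-normalizing subgroup of `G` with `σ(H) = aHa⁻¹` for some `a ∈ G`. Then the map
`μ : G/H → G/H`, `gH ↦ (σ(g)·a)H` is a well-defined `σ`-equivariant involution of
`G/H`, and it is the unique `σ`-equivariant involution of `G/H`. -/
theorem stmt6 (G : Type*) [Group G] (σ : G ≃* G) (hσ : ∀ g : G, σ (σ g) = g)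
    (H : Subgroup G) (hN : Subgroup.normalizer (H : Set G) = H) (a : G)
    (ha : H.map σ.toMonoidHom = H.map (MulAut.conj a).toMonoidHom) :
    ∃ μ : G ⧸ H → G ⧸ H,
      (∀ g : G, μ (g : G ⧸ H) = ((σ g * a : G) : G ⧸ H)) ∧
      (∀ (g : G) (x : G ⧸ H), μ (g • x) = σ g • μ x) ∧
      (∀ x : G ⧸ H, μ (μ x) = x) ∧
      (∀ μ' : G ⧸ H → G ⧸ H,
        (∀ (g : G) (x : G ⧸ H), μ' (g • x) = σ g • μ' x) →
        (∀ x : G ⧸ H, μ' (μ' x) = x) → μ' = μ) := by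
  have key := mem_iff_inv_mul_map_mul_mem ha
  have mem_of_conj (n : G) (hn : ∀ h, h ∈ H ↔ n * h * n⁻¹ ∈ H) : n ∈ H := by
    rw [← hN]
    exact Subgroup.mem_normalizer_iff.2 hn
  have hsq : (σ a * a)⁻¹ ∈ H := mem_of_conj _ fun h ↦ by
    rw [key h, key (a⁻¹ * σ h * a)]
    simp [hσ, mul_assoc]
  let μ : G ⧸ H → G ⧸ H := Quotient.map' (fun g ↦ σ g * a) fun g₁ g₂ hg ↦ by
    rw [QuotientGroup.leftRel_apply] at hg ⊢
    simpa [mul_assoc] using (key _).1 hg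
  have hμ (g : G) : μ (g : G ⧸ H) = ((σ g * a : G) : G ⧸ H) := rfl
  refine ⟨μ, hμ, fun g x ↦ ?_, fun x ↦ ?_, fun μ' heq hinv ↦ funext fun x ↦ ?_⟩
  · induction x using QuotientGroup.induction_on with
    | H x => simp [hμ, mul_assoc]
  · induction x using QuotientGroup.induction_on with
    | H x =>
      rw [hμ, hμ, map_mul, hσ, mul_assoc]
      exact QuotientGroup.mk_mul_of_mem x (inv_mem_iff.1 hsq)
  · obtain ⟨b, hb⟩ := QuotientGroup.mk_surjective (μ' ((1 : G) : G ⧸ H))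
    have hba : b⁻¹ * a ∈ H := mem_of_conj _ fun h ↦ by
      have h₁ := key (σ (a * h * a⁻¹))
      have h₂ := mem_iff_of_equivariant_injective heq
        (Function.Involutive.injective hinv) hb.symm (σ (a * h * a⁻¹))
      rw [hσ] at h₁ h₂
      simpa [mul_assoc] using h₁.symm.trans h₂
    induction x using QuotientGroup.induction_on with
    | H x =>
      have hx : μ' (x : G ⧸ H) = σ x • (b : G ⧸ H) := by
        simpa [hb] using heq x ((1 : G) : G ⧸ H)
      rw [hx, QuotientGroup.eq.2 hba, hμ]
      rfl
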